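/- For any differential graded algebra A over a field, there exists a free (tensor) differential graded algebra T together with a dga morphism T → A that induces an isomorphism on homology. -/

import Mathlib

/-- Transport along an equality of degrees. -/
def cst {A : ℤ → Type} {i j : ℤ} (h : i = j) (a : A i) : A j := h ▸ a

/-- The sign `(-1)^i` for `i : ℤ`. -/
def sgn (i : ℤ) : ℤ := ((-1 : ℤˣ) ^ i : ℤˣ)

/-- A ℤ-graded (non-unital, associative) algebra over `k`, presented degreewise. -/
structure GrAlg (k : Type) [CommRing k] where
  A : ℤ → Type
  [acg : ∀ i, AddCommGroup (A i)]
  [mod : ∀ i, Module k (A i)]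
  mul : ∀ i j : ℤ, A i →ₗ[k] A j →ₗ[k] A (i + j)
  assoc : ∀ (i j l : ℤ) (a : A i) (b : A j) (c : A l),
    cst (add_assoc i j l) (mul (i + j) l (mul i j a b) c) = mul i (j + l) a (mul j l b c)

attribute [instance] GrAlg.acg GrAlg.mod

/-- A differential graded algebra: a graded algebra with a degree `-1` differential
squaring to zero and satisfying the graded Leibniz rule. -/
structure DGA (k : Type) [CommRing k] extends GrAlg k where
  d : ∀ i : ℤ, A i →ₗ[k] A (i - 1)
  dd : ∀ (i : ℤ) (a : A i), d (i - 1) (d i a) = 0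
  leibniz : ∀ (i j : ℤ) (a : A i) (b : A j),
    d (i + j) (mul i j a b) =
      cst (show i - 1 + j = i + j - 1 by ring) (mul (i - 1) j (d i a) b) +
      sgn i • cst (show i + (j - 1) = i + j - 1 by ring) (mul i (j - 1) a (d j b))

/-- A ℤ-graded module (graded vector space when `k` is a field). -/
structure GrMod (k : Type) [CommRing k] where
  V : ℤ → Type
  [acg : ∀ i, AddCommGroup (V i)]
  [mod : ∀ i, Module k (V i)]

attribute [instance] GrMod.acg GrMod.mod

variable {k : Type} [CommRing k]

/-- A morphism of graded algebras. -/
def IsGrHom (T B : GrAlg k) (f : ∀ i, T.A i →ₗ[k] B.A i) : Prop :=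
  ∀ (i j : ℤ) (a : T.A i) (b : T.A j), f (i + j) (T.mul i j a b) = B.mul i j (f i a) (f j b)

/-- `T` is free (as a graded algebra) on the graded vector space `V`, via `ι`:
the universal property of the (non-unital) tensor algebra on `V`. -/
def IsFreeOn (T : GrAlg k) (V : GrMod k) (ι : ∀ i, V.V i →ₗ[k] T.A i) : Prop :=
  ∀ (B : GrAlg k) (f : ∀ i, V.V i →ₗ[k] B.A i),
    ∃! g : ∀ i, T.A i →ₗ[k] B.A i, IsGrHom T B g ∧ ∀ (i : ℤ) (v : V.V i), g i (ι i v) = f i v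

/-- The submodule of elements of degree `i` that are sums of products
(i.e. the degree-`i` part of the "length ≥ 2" ideal of decomposables). -/
def Prods (T : GrAlg k) (i : ℤ) : Submodule k (T.A i) :=
  Submodule.span k
    {a : T.A i | ∃ (p q : ℤ) (h : p + q = i) (x : T.A p) (y : T.A q), a = cst h (T.mul p q x y)}

/-- A morphism of dgas: a graded algebra morphism commuting with the differentials. -/
def IsDGAHom (T B : DGA k) (f : ∀ i, T.A i →ₗ[k] B.A i) : Prop :=
  IsGrHom T.toGrAlg B.toGrAlg f ∧ ∀ (i : ℤ) (a : T.A i), f (i - 1) (T.d i a) = B.d i (f i a)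

/-- `f` induces an isomorphism on homology in every degree. -/
def InducesHomologyIso (T B : DGA k) (f : ∀ i, T.A i →ₗ[k] B.A i) : Prop :=
  ∀ i : ℤ,
    (∀ z : B.A i, B.d i z = 0 →
      ∃ w : T.A i, T.d i w = 0 ∧
        ∃ u : B.A (i + 1), z - f i w = cst (show i + 1 - 1 = i by ring) (B.d (i + 1) u)) ∧
    (∀ w : T.A i, T.d i w = 0 →
      (∃ u : B.A (i + 1), f i w = cst (show i + 1 - 1 = i by ring) (B.d (i + 1) u)) →
      ∃ v : T.A (i + 1), w = cst (show i + 1 - 1 = i by ring) (T.d (i + 1) v))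


namespace FR

/-- Words: nonempty sequences of letters with separators of two kinds. -/
inductive Wd (X : Type) : Type
  | J : X → Wd X
  | P : X → Wd X → Wd X
  | Q : X → Wd X → Wd X

/-- A total (ungraded) dga with sign involution, with a basis. -/
structure TD (k : Type) [CommRing k] (X M : Type) [AddCommGroup M] [Module k M] where
  b : Module.Basis X k M
  mul : M →ₗ[k] M →ₗ[k] M
  d : M →ₗ[k] M
  σ : M →ₗ[k] M
  assoc : ∀ a b c, mul (mul a b) c = mul a (mul b c)
  dd : ∀ a, d (d a) = 0
  σσ : ∀ a, σ (σ a) = a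
  σd : ∀ a, σ (d a) = - d (σ a)
  σmul : ∀ a b, σ (mul a b) = mul (σ a) (σ b)
  leib : ∀ a b, d (mul a b) = mul (d a) b + mul (σ a) (d b)

noncomputable section

variable {k : Type} [CommRing k] {X M : Type} [AddCommGroup M] [Module k M]

abbrev Sp (k : Type) [CommRing k] (X : Type) := Wd X →₀ k

section basic
variable (b : Module.Basis X k M)

def J : M →ₗ[k] Sp k X := b.constr k (fun x => Finsupp.single (Wd.J x) 1)
def P : M →ₗ[k] Sp k X →ₗ[k] Sp k X := b.constr k (fun x => Finsupp.lmapDomain k k (Wd.P x))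
def Q : M →ₗ[k] Sp k X →ₗ[k] Sp k X := b.constr k (fun x => Finsupp.lmapDomain k k (Wd.Q x))

lemma J_b (x : X) : J b (b x) = Finsupp.single (Wd.J x) 1 := by simp [J]
lemma P_b (x : X) (w : Wd X) : P b (b x) (Finsupp.single w 1) = Finsupp.single (Wd.P x w) 1 := by
  simp [P]
lemma Q_b (x : X) (w : Wd X) : Q b (b x) (Finsupp.single w 1) = Finsupp.single (Wd.Q x w) 1 := by
  simp [Q]

variable {N : Type} [AddCommGroup N] [Module k N]

lemma ext_single {F G : Sp k X →ₗ[k] N}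
    (h : ∀ w, F (Finsupp.single w 1) = G (Finsupp.single w 1)) : F = G := by
  apply Finsupp.lhom_ext'
  intro w
  ext
  simpa using h w

lemma ext_S {F G : Sp k X →ₗ[k] N} (hJ : ∀ a, F (J b a) = G (J b a))
    (hP : ∀ a s, F s = G s → F (P b a s) = G (P b a s))
    (hQ : ∀ a s, F s = G s → F (Q b a s) = G (Q b a s)) : ∀ s, F s = G s := by
  have : F = G := by
    apply ext_single
    intro w
    induction w with
    | J x => rw [← J_b b]; exact hJ _
    | P x w ih => rw [← P_b b]; exact hP _ _ ih
    | Q x w ih => rw [← Q_b b]; exact hQ _ _ ih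
  intro s
  rw [this]

def recW (j : M →ₗ[k] N) (p q : M →ₗ[k] (Sp k X × N) →ₗ[k] N) : Wd X → N
  | .J x => j (b x)
  | .P x w => p (b x) (Finsupp.single w 1, recW j p q w)
  | .Q x w => q (b x) (Finsupp.single w 1, recW j p q w)

def recS (j : M →ₗ[k] N) (p q : M →ₗ[k] (Sp k X × N) →ₗ[k] N) : Sp k X →ₗ[k] N :=
  Finsupp.linearCombination k (recW b j p q)

lemma recS_single (j : M →ₗ[k] N) (p q : M →ₗ[k] (Sp k X × N) →ₗ[k] N) (w : Wd X) :
    recS b j p q (Finsupp.single w 1) = recW b j p q w := by simp [recS]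

lemma recS_J (j : M →ₗ[k] N) (p q : M →ₗ[k] (Sp k X × N) →ₗ[k] N) (a : M) :
    recS b j p q (J b a) = j a := by
  have : recS b j p q ∘ₗ J b = j := by
    apply b.ext; intro x; simp [J_b, recS_single, recW]
  exact LinearMap.congr_fun this a

lemma recS_P (j : M →ₗ[k] N) (p q : M →ₗ[k] (Sp k X × N) →ₗ[k] N) (a : M) (s : Sp k X) :
    recS b j p q (P b a s) = p a (s, recS b j p q s) := by
  have : (P b).compr₂ (recS b j p q) =
      p.compl₂ (LinearMap.id.prod (recS b j p q)) := by
    apply b.ext; intro x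
    apply ext_single
    intro w
    simp [P_b, recS_single, recW]
  exact LinearMap.congr_fun (LinearMap.congr_fun this a) s

lemma recS_Q (j : M →ₗ[k] N) (p q : M →ₗ[k] (Sp k X × N) →ₗ[k] N) (a : M) (s : Sp k X) :
    recS b j p q (Q b a s) = q a (s, recS b j p q s) := by
  have : (Q b).compr₂ (recS b j p q) =
      q.compl₂ (LinearMap.id.prod (recS b j p q)) := by
    apply b.ext; intro x
    apply ext_single
    intro w
    simp [Q_b, recS_single, recW]
  exact LinearMap.congr_fun (LinearMap.congr_fun this a) s

end basic

section ops
variable (D : TD k X M)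

local notation "JJ" => J (TD.b D)
local notation "PP" => P (TD.b D)
local notation "QQ" => Q (TD.b D)

def actR : Sp k X →ₗ[k] (M →ₗ[k] Sp k X) :=
  recS D.b
    (LinearMap.mk₂ k (fun c a => JJ (D.mul a c)) (by simp) (by simp) (by simp) (by simp))
    (LinearMap.mk₂ k (fun c sn => (PP).flip sn.1 ∘ₗ D.mul.flip c)
      (by intros; ext; simp) (by intros; ext; simp) (by intros; ext; simp) (by intros; ext; simp))
    (LinearMap.mk₂ k (fun c sn => (QQ).flip sn.1 ∘ₗ D.mul.flip c)
      (by intros; ext; simp) (by intros; ext; simp) (by intros; ext; simp) (by intros; ext; simp))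

def act : M →ₗ[k] Sp k X →ₗ[k] Sp k X := (actR D).flip

@[simp] lemma act_J (a c : M) : act D a (JJ c) = JJ (D.mul a c) := by
  simp [act, actR, recS_J]
@[simp] lemma act_P (a c : M) (s) : act D a (PP c s) = PP (D.mul a c) s := by
  simp [act, actR, recS_P]
@[simp] lemma act_Q (a c : M) (s) : act D a (QQ c s) = QQ (D.mul a c) s := by
  simp [act, actR, recS_Q]

def dS : Sp k X →ₗ[k] Sp k X :=
  recS D.b (JJ ∘ₗ D.d)
    (LinearMap.mk₂ k (fun a sn => PP (D.d a) sn.1 + PP (D.σ a) sn.2)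
      (by intros; simp; abel) (by intros; simp) (by intros; simp; abel) (by intros; simp))
    (LinearMap.mk₂ k (fun a sn => QQ (D.d a) sn.1 + PP (D.σ a) sn.1 - act D (D.σ a) sn.1
        - QQ (D.σ a) sn.2)
      (by intros; simp; abel) (by intros; simp [smul_sub]) (by intros; simp; abel)
      (by intros; simp [smul_sub]))

@[simp] lemma dS_J (a : M) : dS D (JJ a) = JJ (D.d a) := by simp [dS, recS_J]
@[simp] lemma dS_P (a : M) (s) : dS D (PP a s) = PP (D.d a) s + PP (D.σ a) (dS D s) := by
  simp [dS, recS_P]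
@[simp] lemma dS_Q (a : M) (s) : dS D (QQ a s) = QQ (D.d a) s + PP (D.σ a) s - act D (D.σ a) s
    - QQ (D.σ a) (dS D s) := by
  simp [dS, recS_Q]

def fS : Sp k X →ₗ[k] M :=
  recS D.b LinearMap.id
    (LinearMap.mk₂ k (fun a sn => D.mul a sn.2) (by simp) (by simp) (by simp) (by simp)) 0

@[simp] lemma fS_J (a : M) : fS D (JJ a) = a := by simp [fS, recS_J]
@[simp] lemma fS_P (a : M) (s) : fS D (PP a s) = D.mul a (fS D s) := by simp [fS, recS_P]
@[simp] lemma fS_Q (a : M) (s) : fS D (QQ a s) = 0 := by simp [fS, recS_Q]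

def HS : Sp k X →ₗ[k] Sp k X :=
  recS D.b 0
    (LinearMap.mk₂ k (fun a sn => PP (D.σ a) sn.2 + QQ (D.σ a) (JJ (fS D sn.1)))
      (by intros; simp; abel) (by intros; simp) (by intros; simp; abel) (by intros; simp))
    (LinearMap.mk₂ k (fun a sn => - QQ (D.σ a) sn.2)
      (by intros; simp; abel) (by intros; simp) (by intros; simp; abel) (by intros; simp))

@[simp] lemma HS_J (a : M) : HS D (JJ a) = 0 := by simp [HS, recS_J]
@[simp] lemma HS_P (a : M) (s) : HS D (PP a s) =
    PP (D.σ a) (HS D s) + QQ (D.σ a) (JJ (fS D s)) := by simp [HS, recS_P]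
@[simp] lemma HS_Q (a : M) (s) : HS D (QQ a s) = - QQ (D.σ a) (HS D s) := by simp [HS, recS_Q]

def mS : Sp k X →ₗ[k] (Sp k X →ₗ[k] Sp k X) :=
  recS D.b (PP)
    (LinearMap.mk₂ k (fun a sn => (PP a) ∘ₗ sn.2)
      (by intros; ext; simp) (by intros; ext; simp) (by intros; ext; simp) (by intros; ext; simp))
    (LinearMap.mk₂ k (fun a sn => (QQ a) ∘ₗ sn.2)
      (by intros; ext; simp) (by intros; ext; simp) (by intros; ext; simp) (by intros; ext; simp))

@[simp] lemma mS_J (a : M) (t) : mS D (JJ a) t = PP a t := by simp [mS, recS_J]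
@[simp] lemma mS_P (a : M) (s t) : mS D (PP a s) t = PP a (mS D s t) := by simp [mS, recS_P]
@[simp] lemma mS_Q (a : M) (s t) : mS D (QQ a s) t = QQ a (mS D s t) := by simp [mS, recS_Q]

def sS : Sp k X →ₗ[k] Sp k X :=
  recS D.b (JJ ∘ₗ D.σ)
    (LinearMap.mk₂ k (fun a sn => PP (D.σ a) sn.2)
      (by intros; simp) (by intros; simp) (by intros; simp) (by intros; simp))
    (LinearMap.mk₂ k (fun a sn => - QQ (D.σ a) sn.2)
      (by intros; simp; abel) (by intros; simp) (by intros; simp; abel) (by intros; simp))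

@[simp] lemma sS_J (a : M) : sS D (JJ a) = JJ (D.σ a) := by simp [sS, recS_J]
@[simp] lemma sS_P (a : M) (s) : sS D (PP a s) = PP (D.σ a) (sS D s) := by simp [sS, recS_P]
@[simp] lemma sS_Q (a : M) (s) : sS D (QQ a s) = - QQ (D.σ a) (sS D s) := by simp [sS, recS_Q]

lemma act_act (a c : M) (s) : act D a (act D c s) = act D (D.mul a c) s := by
  refine ext_S D.b (F := act D a ∘ₗ act D c) (G := act D (D.mul a c)) ?_ ?_ ?_ s <;>
    intros <;> simp [D.assoc]

lemma mS_act (a : M) (s t) : mS D (act D a s) t = act D a (mS D s t) := by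
  refine ext_S D.b (F := (mS D).flip t ∘ₗ act D a) (G := act D a ∘ₗ (mS D).flip t)
    ?_ ?_ ?_ s <;> intros <;> simp

lemma mS_assoc (r s t) : mS D (mS D r s) t = mS D r (mS D s t) := by
  refine ext_S D.b (F := (mS D).flip t ∘ₗ (mS D).flip s) (G := (mS D).flip (mS D s t))
    ?_ ?_ ?_ r <;> intros <;> simp_all

lemma dS_act (a : M) (s) : dS D (act D a s) = act D (D.d a) s + act D (D.σ a) (dS D s) := by
  refine ext_S D.b (F := dS D ∘ₗ act D a)
    (G := act D (D.d a) + act D (D.σ a) ∘ₗ dS D) ?_ ?_ ?_ s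
  · intro c; simp [D.leib]
  · intro c t h; simp [D.leib, D.σmul]; abel
  · intro c t h; simp [D.leib, D.σmul, act_act]; abel

lemma dS_dS (s) : dS D (dS D s) = 0 := by
  refine ext_S D.b (F := dS D ∘ₗ dS D) (G := 0) ?_ ?_ ?_ s
  · intro c; simp [D.dd]
  · intro c t h; simp at h; simp [D.dd, D.σd, h]
  · intro c t h; simp at h; simp [D.dd, D.σd, D.σσ, h, dS_act]; abel

lemma fS_act (a : M) (s) : fS D (act D a s) = D.mul a (fS D s) := by
  refine ext_S D.b (F := fS D ∘ₗ act D a) (G := D.mul a ∘ₗ fS D) ?_ ?_ ?_ s <;>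
    intros <;> simp [D.assoc]

lemma fS_dS (s) : fS D (dS D s) = D.d (fS D s) := by
  refine ext_S D.b (F := fS D ∘ₗ dS D) (G := D.d ∘ₗ fS D) ?_ ?_ ?_ s
  · intro c; simp
  · intro c t h; simp at h; simp [D.leib, h]
  · intro c t h; simp [fS_act]

lemma fS_mS (s t) : fS D (mS D s t) = D.mul (fS D s) (fS D t) := by
  refine ext_S D.b (F := fS D ∘ₗ (mS D).flip t) (G := D.mul.flip (fS D t) ∘ₗ fS D) ?_ ?_ ?_ s
  · intro c; simp
  · intro c t h; simp at h; simp [h, D.assoc]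
  · intro c t h; simp

lemma leibS (s t) : dS D (mS D s t) = mS D (dS D s) t + mS D (sS D s) (dS D t) := by
  refine ext_S D.b (F := dS D ∘ₗ (mS D).flip t)
    (G := (mS D).flip t ∘ₗ dS D + (mS D).flip (dS D t) ∘ₗ sS D) ?_ ?_ ?_ s
  · intro c; simp
  · intro c t h; simp at h; simp [h]; abel
  · intro c t h; simp at h; simp [h, mS_act]; abel

lemma HS_act (a : M) (s) : HS D (act D a s) = act D (D.σ a) (HS D s) := by
  refine ext_S D.b (F := HS D ∘ₗ act D a) (G := act D (D.σ a) ∘ₗ HS D) ?_ ?_ ?_ s <;>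
    intros <;> simp [D.σmul]

lemma homotopy (s) : dS D (HS D s) + HS D (dS D s) = s - JJ (fS D s) := by
  refine ext_S D.b (F := dS D ∘ₗ HS D + HS D ∘ₗ dS D)
    (G := LinearMap.id - JJ ∘ₗ fS D) ?_ ?_ ?_ s
  · intro c; simp
  · intro c t h
    simp at h
    have h' : dS D (HS D t) = t - JJ (fS D t) - HS D (dS D t) := by rw [← h]; abel
    simp [D.σσ, D.σd, h', fS_dS]; abel
  · intro c t h
    simp at h
    have h' : dS D (HS D t) = t - JJ (fS D t) - HS D (dS D t) := by rw [← h]; abel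
    simp [D.σσ, D.σd, h', HS_act]; abel

end ops

section words

lemma sgn_add (i j : ℤ) : sgn (i + j) = sgn i * sgn j := by
  simp [sgn, zpow_add]

lemma sgn_one : sgn 1 = -1 := by simp [sgn]


def Wd.deg (δ : X → ℤ) : Wd X → ℤ
  | .J x => δ x
  | .P x w => δ x + w.deg δ
  | .Q x w => δ x + 1 + w.deg δ

def Wd.app : Wd X → Wd X → Wd X
  | .J x, v => .P x v
  | .P x w, v => .P x (w.app v)
  | .Q x w, v => .Q x (w.app v)

def Wd.IsGen : Wd X → Prop
  | .J _ => True
  | .P _ _ => False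
  | .Q _ w => w.IsGen

lemma Wd.deg_app (δ : X → ℤ) (w v : Wd X) : (w.app v).deg δ = w.deg δ + v.deg δ := by
  induction w with
  | J x => rfl
  | P x w ih => simp only [app, deg, ih]; ring
  | Q x w ih => simp only [app, deg, ih]; ring

inductive Wd.Gend : Wd X → Prop
  | gen (w : Wd X) : w.IsGen → Gend w
  | mul (w v : Wd X) : w.IsGen → Gend v → Gend (w.app v)

lemma Wd.gend (w : Wd X) : w.Gend := by
  induction w with
  | J x => exact .gen _ trivial
  | P x w ih => exact .mul (.J x) w trivial ih
  | Q x w ih =>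
    cases ih with
    | gen _ h => exact .gen (.Q x w) h
    | mul u v h hv => exact .mul (.Q x u) v h hv

variable {N : Type} [AddCommGroup N] [Module k N] (m : N →ₗ[k] N →ₗ[k] N)

def Wd.ev (φ : Wd X → N) : (Wd X → N) → Wd X → N
  | φ₁, .J x => φ₁ (.J x)
  | φ₁, .P x w => m (φ₁ (.J x)) (Wd.ev φ φ w)
  | φ₁, .Q x w => Wd.ev φ (fun v => φ₁ (.Q x v)) w

lemma Wd.ev_app (hm : ∀ a b c, m (m a b) c = m a (m b c)) (φ φ₁ : Wd X → N) (w v : Wd X) :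
    (w.app v).ev m φ φ₁ = m (w.ev m φ φ₁) (v.ev m φ φ) := by
  induction w generalizing φ₁ with
  | J x => rfl
  | P x w ih => simp only [app, ev, ih, hm]
  | Q x w ih => simp only [app, ev, ih]

lemma Wd.ev_gen (φ φ₁ : Wd X → N) (w : Wd X) (h : w.IsGen) : w.ev m φ φ₁ = φ₁ w := by
  induction w generalizing φ₁ with
  | J x => rfl
  | P x w ih => exact h.elim
  | Q x w ih => simp only [ev]; rw [ih _ h]

lemma Wd.ev_mem (δ : X → ℤ) (G : ℤ → Submodule k N)
    (hm : ∀ i j a b, a ∈ G i → b ∈ G j → m a b ∈ G (i + j))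
    (φ : Wd X → N) (hφ : ∀ w, φ w ∈ G (w.deg δ)) (w : Wd X) : w.ev m φ φ ∈ G (w.deg δ) := by
  induction w.gend with
  | gen w h => rw [Wd.ev_gen m _ _ _ h]; exact hφ w
  | mul w v h hv ih =>
    induction w generalizing v with
    | J x => exact hm _ _ _ _ (hφ (.J x)) ih
    | P => exact h.elim
    | Q x w _ =>
      have key : ∀ (u : Wd X) (φ₁ : Wd X → N), u.IsGen →
          (u.app v).ev m φ φ₁ = m (φ₁ u) (v.ev m φ φ) := by
        intro u
        induction u with
        | J x => intro φ₁ _; rfl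
        | P => intro _ h; exact h.elim
        | Q x u ih => intro φ₁ h; exact ih _ h
      rw [key _ _ h, Wd.deg_app]
      exact hm _ _ _ _ (hφ _) ih

end words

section graded
variable (D : TD k X M) (δ : X → ℤ) (Mg : ℤ → Submodule k M)

local notation "JJ" => J (TD.b D)
local notation "PP" => P (TD.b D)
local notation "QQ" => Q (TD.b D)

lemma mS_single (w v : Wd X) :
    mS D (Finsupp.single w 1) (Finsupp.single v 1) = Finsupp.single (w.app v) 1 := by
  induction w with
  | J x => rw [← J_b D.b]; simp [P_b, Wd.app]
  | P x w ih => rw [← P_b D.b]; rw [mS_P, ih, P_b]; rfl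
  | Q x w ih => rw [← Q_b D.b]; rw [mS_Q, ih, Q_b]; rfl

def Sg (k : Type) [CommRing k] (δ : X → ℤ) (i : ℤ) : Submodule k (Sp k X) :=
  Submodule.span k {s | ∃ w : Wd X, w.deg δ = i ∧ s = Finsupp.single w 1}

lemma single_mem (w : Wd X) : (Finsupp.single w 1 : Sp k X) ∈ Sg k δ (w.deg δ) :=
  Submodule.subset_span ⟨w, rfl, rfl⟩

lemma Sg_map {N : Type} [AddCommGroup N] [Module k N] (F : Sp k X →ₗ[k] N) (i : ℤ)
    (G : Submodule k N) (h : ∀ w : Wd X, w.deg δ = i → F (Finsupp.single w 1) ∈ G) (s : Sp k X)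
    (hs : s ∈ Sg k δ i) : F s ∈ G := by
  have : Sg k δ i ≤ G.comap F := by
    apply Submodule.span_le.2
    rintro _ ⟨w, hw, rfl⟩
    exact h w hw
  exact this hs

/-- Compatibility of the grading with the structure. -/
structure Gr : Prop where
  span : ∀ i, Mg i = Submodule.span k {a | ∃ x, δ x = i ∧ a = D.b x}
  mul : ∀ i j a c, a ∈ Mg i → c ∈ Mg j → D.mul a c ∈ Mg (i + j)
  d : ∀ i a, a ∈ Mg i → D.d a ∈ Mg (i - 1)
  σ : ∀ i a, a ∈ Mg i → D.σ a = sgn i • a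

variable {D δ Mg}

lemma Gr.b (h : Gr D δ Mg) (x : X) : D.b x ∈ Mg (δ x) := by
  rw [h.span]; exact Submodule.subset_span ⟨x, rfl, rfl⟩

lemma Gr.map (h : Gr D δ Mg) {N : Type} [AddCommGroup N] [Module k N] (F : M →ₗ[k] N) (i : ℤ)
    (G : Submodule k N) (hG : ∀ x, δ x = i → F (D.b x) ∈ G) (a : M)
    (ha : a ∈ Mg i) : F a ∈ G := by
  rw [h.span] at ha
  have : Submodule.span k {a | ∃ x, δ x = i ∧ a = D.b x} ≤ G.comap F := by
    apply Submodule.span_le.2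
    rintro _ ⟨w, hw, rfl⟩
    exact hG w hw
  exact this ha

lemma Gr.σ_mem (h : Gr D δ Mg) (i : ℤ) (a : M) (ha : a ∈ Mg i) : D.σ a ∈ Mg i := by
  rw [h.σ i a ha]; exact zsmul_mem ha _

lemma Gr.J (h : Gr D δ Mg) (i : ℤ) (a : M) (ha : a ∈ Mg i) : JJ a ∈ Sg k δ i := by
  refine h.map (JJ) i _ ?_ a ha
  rintro x rfl
  rw [J_b]; exact single_mem δ (.J x)

lemma Gr.P (h : Gr D δ Mg) (i j l : ℤ) (hl : l = i + j) (a : M) (s : Sp k X) (ha : a ∈ Mg i)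
    (hs : s ∈ Sg k δ j) : PP a s ∈ Sg k δ l := by
  refine h.map ((PP).flip s) i _ ?_ a ha
  rintro x rfl
  refine Sg_map δ (PP (D.b x)) j _ ?_ s hs
  rintro w rfl
  rw [P_b, hl]; exact single_mem δ (.P x w)

lemma Gr.Q (h : Gr D δ Mg) (i j l : ℤ) (hl : l = i + 1 + j) (a : M) (s : Sp k X) (ha : a ∈ Mg i)
    (hs : s ∈ Sg k δ j) : QQ a s ∈ Sg k δ l := by
  refine h.map ((QQ).flip s) i _ ?_ a ha
  rintro x rfl
  refine Sg_map δ (QQ (D.b x)) j _ ?_ s hs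
  rintro w rfl
  rw [Q_b, hl]; exact single_mem δ (.Q x w)

lemma Gr.act (h : Gr D δ Mg) (i j l : ℤ) (hl : l = i + j) (a : M) (s : Sp k X) (ha : a ∈ Mg i)
    (hs : s ∈ Sg k δ j) : act D a s ∈ Sg k δ l := by
  refine Sg_map δ (FR.act D a) j _ ?_ s hs
  rintro w rfl
  cases w with
  | J x =>
    rw [← J_b D.b, act_J, hl]; exact h.J _ _ (h.mul _ _ _ _ ha (h.b x))
  | P x w =>
    rw [← P_b D.b, act_P]
    exact h.P _ _ _ (by rw [hl, Wd.deg]; ring) _ _ (h.mul _ _ _ _ ha (h.b x)) (single_mem δ w)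
  | Q x w =>
    rw [← Q_b D.b, act_Q]
    exact h.Q _ _ _ (by rw [hl, Wd.deg]; ring) _ _ (h.mul _ _ _ _ ha (h.b x)) (single_mem δ w)

lemma Gr.dS (h : Gr D δ Mg) (i : ℤ) (s : Sp k X) (hs : s ∈ Sg k δ i) : dS D s ∈ Sg k δ (i - 1) := by
  refine Sg_map δ (FR.dS D) i _ ?_ s hs
  clear hs
  rintro w rfl
  induction w with
  | J x => rw [← J_b D.b, dS_J]; exact h.J _ _ (h.d _ _ (h.b x))
  | P x w ih =>
    rw [← P_b D.b, dS_P]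
    have e : ∀ w : Wd X, (Wd.P x w).deg δ = δ x + w.deg δ := fun _ => rfl
    rw [e]
    exact add_mem (h.P _ _ _ (by ring) _ _ (h.d _ _ (h.b x)) (single_mem δ w))
      (h.P _ _ _ (by ring) _ _ (h.σ_mem _ _ (h.b x)) ih)
  | Q x w ih =>
    rw [← Q_b D.b, dS_Q]
    have e : ∀ w : Wd X, (Wd.Q x w).deg δ = δ x + 1 + w.deg δ := fun _ => rfl
    rw [e]
    exact sub_mem (sub_mem (add_mem
      (h.Q _ _ _ (by ring) _ _ (h.d _ _ (h.b x)) (single_mem δ w))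
      (h.P _ _ _ (by ring) _ _ (h.σ_mem _ _ (h.b x)) (single_mem δ w)))
      (h.act _ _ _ (by ring) _ _ (h.σ_mem _ _ (h.b x)) (single_mem δ w)))
      (h.Q _ _ _ (by ring) _ _ (h.σ_mem _ _ (h.b x)) ih)

lemma Gr.fS (h : Gr D δ Mg) (i : ℤ) (s : Sp k X) (hs : s ∈ Sg k δ i) : fS D s ∈ Mg i := by
  refine Sg_map δ (FR.fS D) i _ ?_ s hs
  clear hs
  rintro w rfl
  induction w with
  | J x => rw [← J_b D.b, fS_J]; exact h.b x
  | P x w ih => rw [← P_b D.b, fS_P]; exact h.mul _ _ _ _ (h.b x) ih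
  | Q x w ih => rw [← Q_b D.b, fS_Q]; exact zero_mem _

lemma Gr.HS (h : Gr D δ Mg) (i : ℤ) (s : Sp k X) (hs : s ∈ Sg k δ i) : HS D s ∈ Sg k δ (i + 1) := by
  refine Sg_map δ (FR.HS D) i _ ?_ s hs
  clear hs
  rintro w rfl
  induction w with
  | J x => rw [← J_b D.b, HS_J]; exact zero_mem _
  | P x w ih =>
    rw [← P_b D.b, HS_P]
    have e : ∀ w : Wd X, (Wd.P x w).deg δ = δ x + w.deg δ := fun _ => rfl
    rw [e]
    exact add_mem (h.P _ _ _ (by ring) _ _ (h.σ_mem _ _ (h.b x)) ih)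
      (h.Q _ _ _ (by ring) _ _ (h.σ_mem _ _ (h.b x)) (h.J _ _ (h.fS _ _ (single_mem δ w))))
  | Q x w ih =>
    rw [← Q_b D.b, HS_Q]
    have e : ∀ w : Wd X, (Wd.Q x w).deg δ = δ x + 1 + w.deg δ := fun _ => rfl
    rw [e]
    exact neg_mem (h.Q _ _ _ (by ring) _ _ (h.σ_mem _ _ (h.b x)) ih)

lemma mS_mem (i j : ℤ) (s t : Sp k X) (hs : s ∈ Sg k δ i) (ht : t ∈ Sg k δ j) :
    mS D s t ∈ Sg k δ (i + j) := by
  refine Sg_map δ ((mS D).flip t) i _ ?_ s hs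
  rintro w rfl
  refine Sg_map δ (mS D (Finsupp.single w 1)) j _ ?_ t ht
  rintro v rfl
  rw [mS_single, ← Wd.deg_app]
  exact single_mem δ _

lemma Gr.sS (h : Gr D δ Mg) (i : ℤ) (s : Sp k X) (hs : s ∈ Sg k δ i) : sS D s = sgn i • s := by
  have : (FR.sS D - sgn i • (LinearMap.id : Sp k X →ₗ[k] Sp k X)) s ∈ (⊥ : Submodule k (Sp k X)) := by
    refine Sg_map δ _ i _ ?_ s hs
    clear hs
    rintro w rfl
    suffices FR.sS D (Finsupp.single w 1) = sgn (w.deg δ) • Finsupp.single w 1 by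
      simpa [sub_eq_zero] using this
    induction w with
    | J x => rw [← J_b D.b, sS_J, h.σ _ _ (h.b x), map_zsmul]; rfl
    | P x w ih =>
      rw [← P_b D.b, sS_P, h.σ _ _ (h.b x), ih, Wd.deg, sgn_add, map_zsmul,
        map_zsmul, LinearMap.smul_apply, smul_smul, mul_comm]
    | Q x w ih =>
      rw [← Q_b D.b, sS_Q, h.σ _ _ (h.b x), ih, Wd.deg, sgn_add, sgn_add,
        map_zsmul, sgn_one,
        map_zsmul, LinearMap.smul_apply, smul_smul, mul_comm, ← neg_smul]
      congr 1; ring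
  simpa [sub_eq_zero] using this

end graded

section total

abbrev Tt (B : GrAlg k) := DirectSum ℤ B.A

variable (B : GrAlg k)

def lo (i : ℤ) : B.A i →ₗ[k] Tt B := DirectSum.lof k ℤ B.A i

lemma lo_cst {i j : ℤ} (h : i = j) (a : B.A i) : lo B j (cst h a) = lo B i a := by
  subst h; rfl

lemma lo_inj (i : ℤ) : Function.Injective (lo B i) := DirectSum.of_injective i

def co (i : ℤ) : Tt B →ₗ[k] B.A i := DirectSum.component k ℤ B.A i

lemma co_lo (i : ℤ) (a : B.A i) : co B i (lo B i a) = a := DirectSum.component.lof_self ..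

lemma tt_ext {N : Type} [AddCommGroup N] [Module k N] {F G : Tt B →ₗ[k] N}
    (h : ∀ i a, F (lo B i a) = G (lo B i a)) (s : Tt B) : F s = G s := by
  have : F = G := DirectSum.linearMap_ext k (fun i => LinearMap.ext (h i))
  rw [this]

def tm : Tt B →ₗ[k] Tt B →ₗ[k] Tt B :=
  DirectSum.toModule k ℤ _ (fun i => LinearMap.flip
    (DirectSum.toModule k ℤ _ (fun j => ((B.mul i j).compr₂ (lo B (i + j))).flip)))

lemma tm_lo (i j : ℤ) (a : B.A i) (c : B.A j) :
    tm B (lo B i a) (lo B j c) = lo B (i + j) (B.mul i j a c) := by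
  simp [tm, lo]

lemma tm_assoc (x y z : Tt B) : tm B (tm B x y) z = tm B x (tm B y z) := by
  refine tt_ext B (F := (tm B).flip z ∘ₗ (tm B).flip y) (G := (tm B).flip (tm B y z)) ?_ x
  intro i a
  refine tt_ext B (F := (tm B).flip z ∘ₗ tm B (lo B i a))
    (G := tm B (lo B i a) ∘ₗ (tm B).flip z) ?_ y
  intro j c
  refine tt_ext B (F := tm B (tm B (lo B i a) (lo B j c)))
    (G := tm B (lo B i a) ∘ₗ tm B (lo B j c)) ?_ z
  intro l e
  simp only [LinearMap.comp_apply, tm_lo, ← B.assoc, lo_cst]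

def tg (i : ℤ) : Submodule k (Tt B) := LinearMap.range (lo B i)

lemma lo_co (i : ℤ) (s : Tt B) (h : s ∈ tg B i) : lo B i (co B i s) = s := by
  obtain ⟨a, rfl⟩ := h
  rw [co_lo]

lemma tm_mem (i j : ℤ) (s t) (hs : s ∈ tg B i) (ht : t ∈ tg B j) : tm B s t ∈ tg B (i + j) := by
  obtain ⟨a, rfl⟩ := hs
  obtain ⟨c, rfl⟩ := ht
  exact ⟨_, (tm_lo B i j a c).symm⟩

variable (A : DGA k)

def td : Tt A.toGrAlg →ₗ[k] Tt A.toGrAlg :=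
  DirectSum.toModule k ℤ _ (fun i => lo A.toGrAlg (i - 1) ∘ₗ A.d i)

lemma td_lo (i : ℤ) (a : A.A i) : td A (lo _ i a) = lo _ (i - 1) (A.d i a) := by
  simp [td, lo]

def ts : Tt B →ₗ[k] Tt B :=
  DirectSum.toModule k ℤ _ (fun i => sgn i • lo B i)

lemma ts_lo (i : ℤ) (a : B.A i) : ts B (lo _ i a) = sgn i • lo _ i a := by
  simp [ts, lo]

lemma sgn_sq (i : ℤ) : sgn i * sgn i = 1 := by
  simp [sgn, ← Units.val_mul]

lemma sgn_sub_one (i : ℤ) : sgn (i - 1) = - sgn i := by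
  simp [sgn, zpow_sub]

def tD {X : Type} (b : Module.Basis X k (Tt A.toGrAlg)) : TD k X (Tt A.toGrAlg) where
  b := b
  mul := tm _
  d := td A
  σ := ts _
  assoc := tm_assoc _
  dd s := by
    refine tt_ext _ (F := td A ∘ₗ td A) (G := 0) ?_ s
    intro i a
    simp [td_lo, A.dd]
  σσ s := by
    refine tt_ext _ (F := ts _ ∘ₗ ts _) (G := LinearMap.id) ?_ s
    intro i a
    simp [ts_lo, smul_smul, sgn_sq]
  σd s := by
    refine tt_ext _ (F := ts _ ∘ₗ td A) (G := - (td A ∘ₗ ts _)) ?_ s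
    intro i a
    simp [ts_lo, td_lo, sgn_sub_one]
  σmul s t := by
    refine tt_ext _ (F := ts _ ∘ₗ (tm _).flip t) (G := (tm _).flip (ts _ t) ∘ₗ ts _) ?_ s
    intro i a
    refine tt_ext _ (F := ts _ ∘ₗ (tm _ (lo _ i a))) (G := (tm _ (ts _ (lo _ i a))) ∘ₗ ts _) ?_ t
    intro j c
    simp [ts_lo, tm_lo, smul_smul, sgn_add, mul_comm]
  leib s t := by
    refine tt_ext _ (F := td A ∘ₗ (tm _).flip t)
      (G := (tm _).flip t ∘ₗ td A + (tm _).flip (td A t) ∘ₗ ts _) ?_ s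
    intro i a
    refine tt_ext _ (F := td A ∘ₗ (tm _ (lo _ i a)))
      (G := (tm _ (td A (lo _ i a))) + (tm _ (ts _ (lo _ i a))) ∘ₗ td A) ?_ t
    intro j c
    simp [ts_lo, tm_lo, td_lo, A.leibniz, lo_cst]

end total

section construction
variable {D : TD k X M} {δ : X → ℤ} {Mg : ℤ → Submodule k M}

lemma coe_cst {i j : ℤ} (e : i = j) (a : Sg k δ i) :
    ((cst (A := fun i => Sg k δ i) e a : Sg k δ j) : Sp k X) = a := by
  subst e; rfl

/-- The free graded algebra. -/
def TG (D : TD k X M) (δ : X → ℤ) : GrAlg k where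
  A i := Sg k δ i
  mul i j := LinearMap.mk₂ k (fun s t => ⟨mS D s t, mS_mem i j _ _ s.2 t.2⟩)
    (by intros; apply Subtype.ext; simp) (by intros; apply Subtype.ext; simp)
    (by intros; apply Subtype.ext; simp) (by intros; apply Subtype.ext; simp)
  assoc i j l a b c := by
    apply Subtype.ext
    rw [coe_cst]
    exact mS_assoc D _ _ _

/-- The free dga. -/
def TA (h : Gr D δ Mg) : DGA k where
  toGrAlg := TG D δ
  d i := (dS D).restrict (h.dS i)
  dd i a := Subtype.ext (dS_dS D _)
  leibniz i j a b := by
    apply Subtype.ext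
    refine (leibS D _ _).trans ?_
    rw [h.sS i _ a.2]
    erw [Submodule.coe_add, coe_cst, Submodule.coe_smul_of_tower, coe_cst]
    rw [map_zsmul]
    rfl

/-- The generators. -/
def GV (k : Type) [CommRing k] (δ : X → ℤ) : GrMod k where
  V i := {w : Wd X // w.IsGen ∧ w.deg δ = i} →₀ k

def wsing (k : Type) [CommRing k] (δ : X → ℤ) (i : ℤ) (w : Wd X) (h : w.deg δ = i) : Sg k δ i :=
  ⟨Finsupp.single w 1, h ▸ single_mem δ w⟩

def gι (D : TD k X M) (δ : X → ℤ) (i : ℤ) : (GV k δ).V i →ₗ[k] (TG D δ).A i :=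
  Finsupp.linearCombination k
    (fun w : {w : Wd X // w.IsGen ∧ w.deg δ = i} => wsing k δ i w.1 w.2.2)

lemma gι_single (i : ℤ) (w : {w : Wd X // w.IsGen ∧ w.deg δ = i}) :
    gι D δ i (Finsupp.single w 1 : _ →₀ k) = wsing k δ i w.1 w.2.2 := by
  refine (Finsupp.linearCombination_single _ _ _).trans (one_smul _ _)

lemma Sg_ext {N : Type} [AddCommGroup N] [Module k N] (i : ℤ) (F G : Sg k δ i →ₗ[k] N)
    (h : ∀ w hw, F (wsing k δ i w hw) = G (wsing k δ i w hw)) : F = G := by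
  ext ⟨s, hs⟩
  induction hs using Submodule.span_induction with
  | mem s hs => obtain ⟨w, hw, rfl⟩ := hs; exact h w hw
  | zero => exact (map_zero F).trans (map_zero G).symm
  | add x y hx hy ihx ihy =>
    have e : (⟨x + y, Submodule.add_mem _ hx hy⟩ : Sg k δ i) = ⟨x, hx⟩ + ⟨y, hy⟩ := rfl
    exact (congrArg F e).trans (((map_add F _ _).trans
      (congrArg₂ (· + ·) ihx ihy)).trans (map_add G _ _).symm)
  | smul c x hx ih =>
    have e : (⟨c • x, Submodule.smul_mem _ c hx⟩ : Sg k δ i) = c • ⟨x, hx⟩ := rfl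
    exact (congrArg F e).trans (((map_smul F _ _).trans
      (congrArg (c • ·) ih)).trans (map_smul G _ _).symm)

lemma wsing_app (w v : Wd X) : wsing k δ (w.deg δ + v.deg δ) (w.app v) (Wd.deg_app δ w v) =
    (TG D δ).mul _ _ (wsing k δ _ w rfl) (wsing k δ _ v rfl) := by
  apply Subtype.ext
  exact (mS_single D w v).symm

open Classical in
def phi (B : GrAlg k) (f : ∀ i, (GV k δ).V i →ₗ[k] B.A i) (w : Wd X) : Tt B :=
  if h : w.IsGen then lo B (w.deg δ) (f (w.deg δ) (Finsupp.single
    (⟨w, h, rfl⟩ : {v : Wd X // v.IsGen ∧ v.deg δ = w.deg δ}) (1 : k))) else 0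

lemma phi_mem (B : GrAlg k) (f : ∀ i, (GV k δ).V i →ₗ[k] B.A i) (w : Wd X) :
    phi B f w ∈ tg B (w.deg δ) := by
  unfold phi
  split_ifs
  · exact ⟨_, rfl⟩
  · exact zero_mem _

def evS (B : GrAlg k) (f : ∀ i, (GV k δ).V i →ₗ[k] B.A i) : Sp k X →ₗ[k] Tt B :=
  Finsupp.linearCombination k (Wd.ev (tm B) (phi B f) (phi B f))

lemma evS_single (B : GrAlg k) (f : ∀ i, (GV k δ).V i →ₗ[k] B.A i) (w : Wd X) :
    evS B f (Finsupp.single w 1) = w.ev (tm B) (phi B f) (phi B f) := by simp [evS]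

lemma evS_mul (D : TD k X M) (B : GrAlg k) (f : ∀ i, (GV k δ).V i →ₗ[k] B.A i) (s t : Sp k X) :
    evS B f (mS D s t) = tm B (evS B f s) (evS B f t) := by
  have : (mS D).compr₂ (evS B f) = (tm B).compl₁₂ (evS B f) (evS B f) := by
    apply ext_single; intro w
    apply ext_single; intro v
    simp only [LinearMap.compr₂_apply, LinearMap.compl₁₂_apply, mS_single, evS_single]
    exact Wd.ev_app _ (tm_assoc B) _ _ _ _
  exact LinearMap.congr_fun (LinearMap.congr_fun this s) t

lemma evS_mem (B : GrAlg k) (f : ∀ i, (GV k δ).V i →ₗ[k] B.A i) (i : ℤ) (s : Sp k X)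
    (hs : s ∈ Sg k δ i) : evS B f s ∈ tg B i := by
  refine Sg_map δ (evS B f) i _ ?_ s hs
  rintro w rfl
  rw [evS_single]
  exact Wd.ev_mem _ δ (tg B) (tm_mem B) _ (phi_mem B f) w

theorem TG_free (D : TD k X M) (δ : X → ℤ) : IsFreeOn (TG D δ) (GV k δ) (gι D δ) := by
  intro B f
  refine ⟨fun i => co B i ∘ₗ evS B f ∘ₗ (Sg k δ i).subtype, ⟨?_, ?_⟩, ?_⟩
  · intro i j a c
    apply lo_inj
    rw [← tm_lo]
    erw [lo_co B _ _ (evS_mem B f _ _ (mS_mem i j _ _ a.2 c.2)),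
      lo_co B _ _ (evS_mem B f _ _ a.2), lo_co B _ _ (evS_mem B f _ _ c.2)]
    exact evS_mul D B f _ _
  · intro i v
    have : (co B i ∘ₗ evS B f ∘ₗ (Sg k δ i).subtype) ∘ₗ (gι D δ i) = f i := by
      apply Finsupp.lhom_ext'
      rintro ⟨w, hw, rfl⟩
      ext
      change co B _ (evS B f (gι D δ (w.deg δ) (Finsupp.single _ 1 : _ →₀ k)).1) =
        f _ (Finsupp.single _ 1)
      rw [gι_single]
      change co B _ (evS B f (Finsupp.single w 1)) = _
      rw [evS_single, Wd.ev_gen _ _ _ _ hw, phi, dif_pos hw, co_lo]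
    exact LinearMap.congr_fun this v
  · rintro g ⟨hg, hgι⟩
    suffices key : ∀ (w : Wd X) (i : ℤ) (hw : w.deg δ = i),
        g i (wsing k δ i w hw) = co B i (evS B f (Finsupp.single w 1)) by
      funext i
      exact Sg_ext i _ _ (fun w hw => key w i hw)
    have gw : ∀ w : Wd X, w.IsGen →
        lo B _ (g _ (wsing k δ (w.deg δ) w rfl)) = phi B f w := by
      intro w hw
      rw [phi, dif_pos hw]
      exact congrArg (lo B _) ((congrArg (g _) (gι_single _ ⟨w, hw, rfl⟩).symm).trans (hgι _ _))
    rintro w i rfl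
    apply lo_inj
    rw [lo_co B _ _ (evS_mem B f _ _ (single_mem δ w)), evS_single]
    induction w.gend with
    | gen w hw =>
      rw [Wd.ev_gen _ _ _ _ hw]
      exact gw w hw
    | mul w v hw hv ih =>
      have key : ∀ (i : ℤ) (e : (w.app v).deg δ = i),
          lo B _ (g _ (wsing k δ _ (w.app v) rfl)) = lo B i (g i (wsing k δ i (w.app v) e)) := by
        rintro i rfl; rfl
      rw [key _ (Wd.deg_app δ w v), wsing_app (D := D), Wd.ev_app _ (tm_assoc B),
        Wd.ev_gen _ _ _ _ hw, ← ih]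
      erw [hg]
      rw [← tm_lo, ← gw w hw]

end construction

section final
variable {k : Type} [Field k] (A : DGA k)

abbrev Ix := Σ i : ℤ, Module.Basis.ofVectorSpaceIndex k (A.A i)

def bas : Module.Basis (Ix A) k (Tt A.toGrAlg) :=
  DFinsupp.basis (fun i => Module.Basis.ofVectorSpace k (A.A i))

lemma bas_apply (x : Ix A) :
    bas A x = lo A.toGrAlg x.1 (Module.Basis.ofVectorSpace k (A.A x.1) x.2) := by
  obtain ⟨i, j⟩ := x
  change (DFinsupp.mapRange.linearEquiv
    (fun i => (Module.Basis.ofVectorSpace k (A.A i)).repr)).symm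
      (sigmaFinsuppEquivDFinsupp (Finsupp.single _ 1)) = _
  rw [sigmaFinsuppEquivDFinsupp_single]
  rw [LinearEquiv.symm_apply_eq]
  refine Eq.trans ?_ (DFinsupp.mapRange_single (hf := fun i => map_zero _)).symm
  rw [Module.Basis.repr_self]

lemma bas_gr : Gr (tD A (bas A)) (fun x => x.1) (tg A.toGrAlg) where
  span i := by
    apply le_antisymm
    · rintro _ ⟨a, rfl⟩
      have ha : a ∈ Submodule.span k (Set.range (Module.Basis.ofVectorSpace k (A.A i))) := by
        rw [Module.Basis.span_eq]; trivial
      have := Submodule.mem_map_of_mem (f := lo A.toGrAlg i) ha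
      rw [Submodule.map_span] at this
      refine Submodule.span_mono ?_ this
      rintro _ ⟨_, ⟨j, rfl⟩, rfl⟩
      exact ⟨⟨i, j⟩, rfl, (bas_apply A ⟨i, j⟩).symm⟩
    · apply Submodule.span_le.2
      rintro _ ⟨⟨i, j⟩, rfl, rfl⟩
      exact ⟨_, (bas_apply A ⟨i, j⟩).symm⟩
  mul := tm_mem _
  d := by
    rintro i _ ⟨a, rfl⟩
    exact ⟨_, (td_lo A i a).symm⟩
  σ := by
    rintro i _ ⟨a, rfl⟩
    exact ts_lo _ i a

theorem main_aux {X : Type} (D : TD k X (Tt A.toGrAlg)) (δ : X → ℤ) (h : Gr D δ (tg A.toGrAlg))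
    (hm : ∀ a c, D.mul a c = tm _ a c) (hd : ∀ a, D.d a = td A a) : ∃ (T : DGA k) (V : GrMod k) (ι : ∀ i, V.V i →ₗ[k] T.A i),
      IsFreeOn T.toGrAlg V ι ∧
      ∃ f : ∀ i, T.A i →ₗ[k] A.A i, IsDGAHom T A f ∧ InducesHomologyIso T A f := by
  refine ⟨TA h, GV k _, gι D _, TG_free _ _,
    fun i => co A.toGrAlg i ∘ₗ fS D ∘ₗ (Sg k _ i).subtype, ?_⟩
  have hf : ∀ i (s : (TA h).A i), lo A.toGrAlg i (co A.toGrAlg i (fS D s.1)) =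
      fS D s.1 := fun i s => lo_co _ _ _ (h.fS i _ s.2)
  refine ⟨⟨?_, ?_⟩, ?_⟩
  · intro i j a c
    apply lo_inj
    rw [← tm_lo]
    refine (hf _ _).trans ?_
    refine (fS_mS D _ _).trans ?_
    rw [hm]
    exact congrArg₂ (fun x y => tm A.toGrAlg x y) (hf _ a).symm (hf _ c).symm
  · intro i a
    apply lo_inj
    rw [← td_lo]
    refine (hf _ _).trans ?_
    refine (fS_dS D _).trans ?_
    rw [hd]
    exact congrArg (td A) (hf _ a).symm
  · intro i
    constructor
    · intro z hz
      have hz0 := hf i ⟨J D.b (lo _ i z), h.J i _ ⟨z, rfl⟩⟩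
      have hz1 : co A.toGrAlg i (fS D (J D.b (lo _ i z))) = z := by
        apply lo_inj
        rw [hz0, fS_J]
      refine ⟨⟨J D.b (lo _ i z), h.J i _ ⟨z, rfl⟩⟩, ?_, 0, ?_⟩
      · apply Subtype.ext
        refine (dS_J D _).trans ?_
        have : D.d (lo _ i z) = 0 := by
          rw [hd, td_lo, hz, map_zero]
        rw [this, map_zero]; rfl
      · apply lo_inj
        rw [lo_cst, map_zero, map_zero]
        refine (congrArg (lo _ i) (sub_eq_zero.2 hz1.symm)).trans (map_zero _)
    · rintro w hw ⟨u, hu⟩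
      have hu' : fS D w.1 = td A (lo _ _ u) := by
        rw [← hf, td_lo, ← lo_cst A.toGrAlg (show i + 1 - 1 = i by ring), ← hu]; rfl
      have hw' : dS D w.1 = 0 := congrArg Subtype.val hw
      refine ⟨⟨HS D w.1 + J D.b (lo _ (i + 1) u),
        add_mem (h.HS i _ w.2) (h.J _ _ ⟨u, rfl⟩)⟩, ?_⟩
      apply Subtype.ext
      refine Eq.trans ?_ (coe_cst _ _).symm
      change w.1 = dS D (HS D w.1 + J D.b (lo _ (i + 1) u))
      have key := homotopy D w.1
      rw [hw', map_zero, add_zero] at key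
      rw [map_add, key, hu', ← hd]
      have := dS_J D (lo _ (i + 1) u)
      refine Eq.trans ?_ (congrArg (_ + ·) this).symm
      exact (sub_add_cancel _ _).symm

theorem main : ∃ (T : DGA k) (V : GrMod k) (ι : ∀ i, V.V i →ₗ[k] T.A i),
      IsFreeOn T.toGrAlg V ι ∧
      ∃ f : ∀ i, T.A i →ₗ[k] A.A i, IsDGAHom T A f ∧ InducesHomologyIso T A f :=
  main_aux A (tD A (bas A)) _ (bas_gr A) (fun _ _ => rfl) (fun _ => rfl)

end final

end

end FR

/-- every dga over a field admits a resolution: a dga morphism from a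
free dga (free as a graded algebra on some graded vector space) inducing an
isomorphism on homology in every degree. -/
theorem exists_free_resolution {k : Type} [Field k] (A : DGA k) :
    ∃ (T : DGA k) (V : GrMod k) (ι : ∀ i, V.V i →ₗ[k] T.A i),
      IsFreeOn T.toGrAlg V ι ∧
      ∃ f : ∀ i, T.A i →ₗ[k] A.A i, IsDGAHom T A f ∧ InducesHomologyIso T A f := by
  exact FR.main A
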